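/- Let A be an Artin algebra and (C,T) a tilting pair of self-orthogonal modules in mod A. Then ^⊥(_TX) ∩ _TX = add T: a module M satisfying Ext^i(M,X)=0 for all X∈_TX and i≥1 and lying in _TX must belong to add T. -/

import Mathlib

open CategoryTheory CategoryTheory.Limits Opposite

noncomputable section

universe v u

variable (C : Type u) [Category.{v} C] [Abelian C] [EnoughProjectives C] [EnoughInjectives C]

/-- The `i`-th Ext group from `X` to `Y` vanishes. -/
def extZero (i : ℕ) (X Y : C) : Prop :=
  Limits.IsZero (((Ext ℤ C i).obj (op X)).obj Y)

variable {C}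

/-- A class of objects is self-orthogonal if all positive-degree Ext groups
between its members vanish. -/
def SelfOrth (ω : Set C) : Prop :=
  ∀ W ∈ ω, ∀ W' ∈ ω, ∀ i ≥ 1, extZero C i W W'

/-- The right orthogonal class `ω^⊥`. -/
def rightPerp (ω : Set C) : Set C :=
  {Y | ∀ W ∈ ω, ∀ i ≥ 1, extZero C i W Y}

/-- The left orthogonal class `^⊥ω`. -/
def leftPerp (ω : Set C) : Set C :=
  {Y | ∀ W ∈ ω, ∀ i ≥ 1, extZero C i Y W}

/-- There exists a short exact sequence `0 → X → Y → Z → 0`. -/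
def SES (X Y Z : C) : Prop :=
  ∃ (f : X ⟶ Y) (g : Y ⟶ Z) (w : f ≫ g = 0), (ShortComplex.mk f g w).ShortExact

/-- `coresol ω n` is the class of objects admitting an `ω`-coresolution
`0 → X → W⁰ → ⋯ → Wⁿ → 0` of length `n`. -/
def coresol (ω : Set C) : ℕ → Set C
  | 0 => {X | ∃ W ∈ ω, Nonempty (X ≅ W)}
  | n + 1 => {X | ∃ W ∈ ω, ∃ X', SES X W X' ∧ X' ∈ coresol ω n}

/-- `check(ω)`: objects with a finite `ω`-coresolution. -/
def checkCat (ω : Set C) : Set C := ⋃ n, coresol ω n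

/-- `resol ω n` is the class of objects admitting an `ω`-resolution
`0 → Wₙ → ⋯ → W₀ → X → 0` of length `n`. -/
def resol (ω : Set C) : ℕ → Set C
  | 0 => {X | ∃ W ∈ ω, Nonempty (X ≅ W)}
  | n + 1 => {X | ∃ W ∈ ω, ∃ X', SES X' W X ∧ X' ∈ resol ω n}

/-- `hat(ω)`: objects with a finite `ω`-resolution. -/
def hatCat (ω : Set C) : Set C := ⋃ n, resol ω n

/-- `_ωX`: objects admitting an exact proper `ω`-resolution
`⋯ → W₁ → W₀ → A → 0` with all syzygies in `ω^⊥`. -/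
def omX (ω : Set C) : Set C :=
  {A | ∃ K W : ℕ → C, K 0 = A ∧ (∀ i, W i ∈ ω) ∧
    (∀ i, K (i + 1) ∈ rightPerp ω) ∧ ∀ i, SES (K (i + 1)) (W i) (K i)}

/-- `X_ω`: objects admitting an exact coproper `ω`-coresolution
`0 → A → W⁰ → W¹ → ⋯` with all cosyzygies in `^⊥ω`. -/
def Xom (ω : Set C) : Set C :=
  {A | ∃ K W : ℕ → C, K 0 = A ∧ (∀ i, W i ∈ ω) ∧
    (∀ i, K (i + 1) ∈ leftPerp ω) ∧ ∀ i, SES (K i) (W i) (K (i + 1))}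

/-- `Pres^n_D(ω)`: objects `M` with an exact sequence
`0 → X → Tₙ → ⋯ → T₁ → M → 0`, `Tᵢ ∈ ω`, `X ∈ D`. -/
def Pres (D ω : Set C) : ℕ → Set C
  | 0 => D
  | n + 1 => {M | ∃ T ∈ ω, ∃ X, SES X T M ∧ X ∈ Pres D ω n}

/-- `ω`-codimension: the least length of an `ω`-coresolution. -/
def codim (ω : Set C) (M : C) : ℕ := sInf {n | M ∈ coresol ω n}

/-- `I` is a relative injective cogenerator of `Y`. -/
def RelInjCogen (I Y : Set C) : Prop :=
  I ⊆ Y ∧ (∀ X ∈ I, ∀ Z ∈ Y, ∀ i ≥ 1, extZero C i Z X) ∧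
    ∀ Z ∈ Y, ∃ I₀ ∈ I, ∃ Z', Z' ∈ Y ∧ SES Z I₀ Z'

/-- The direct sum of `n + 1` copies of `T`. -/
def nsum (T : C) : ℕ → C
  | 0 => T
  | n + 1 => T ⊞ nsum T n

/-- `add T`: direct summands of finite direct sums of copies of `T`. -/
def addOf (T : C) : Set C :=
  {X | ∃ (n : ℕ) (Y : C), Nonempty ((X ⊞ Y) ≅ nsum T n)}


section ArtinAlgebra

variable (R : Type) [CommRing R] [IsArtinianRing R]
variable (A : Type) [Ring A] [Algebra R A] [Module.Finite R A]
variable [Abelian (FGModuleCat A)] [EnoughProjectives (FGModuleCat A)]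
variable [EnoughInjectives (FGModuleCat A)]

/-- `M` is a self-orthogonal module: `Ext^i(M, M) = 0` for all `i ≥ 1`. -/
def SelfOrthMod (M : FGModuleCat A) : Prop :=
  ∀ i ≥ 1, extZero (FGModuleCat A) i M M

/-- `(C, T)` is a tilting pair in `mod A`. -/
def TiltingPair (Cm Tm : FGModuleCat A) : Prop :=
  SelfOrthMod A Cm ∧ SelfOrthMod A Tm ∧
    Tm ∈ hatCat (addOf Cm) ∧ Cm ∈ checkCat (addOf Tm)

/-- `(C, T)` is an `n`-tilting pair: a tilting pair with `add C`-resolution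
dimension of `add T` at most `n`. -/
def nTiltingPair (Cm Tm : FGModuleCat A) (n : ℕ) : Prop :=
  TiltingPair A Cm Tm ∧ ∀ X ∈ addOf Tm, X ∈ resol (addOf Cm) n

end ArtinAlgebra

section AbelianCategory

variable {𝓐 : Type u} [Category.{v} 𝓐] [Abelian 𝓐]

/-- In positive degrees, vanishing of the derived-functor Ext agrees with vanishing of the
Ext groups defined through the derived category. -/
lemma extZero_iff_subsingleton [HasExt.{v} 𝓐] [EnoughProjectives 𝓐] {i : ℕ} (hi : 1 ≤ i) (X Y : 𝓐) :
    extZero 𝓐 i X Y ↔ Subsingleton (Abelian.Ext X Y i) := by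
  obtain ⟨p, rfl⟩ : ∃ p, i = p + 1 := ⟨i - 1, by omega⟩
  let P := projectiveResolution X
  have key : extZero 𝓐 (p + 1) X Y ↔ ∀ f : P.complex.X (p + 1) ⟶ Y,
      P.complex.d (p + 2) (p + 1) ≫ f = 0 →
        ∃ g : P.complex.X p ⟶ Y, P.complex.d (p + 1) p ≫ g = f := by
    rw [extZero, (P.isoExt (R := ℤ) (p + 1) Y).isZero_iff,
      ← HomologicalComplex.exactAt_iff_isZero_homology,
      HomologicalComplex.exactAt_iff' _ p (p + 1) (p + 2) (by simp) (by simp),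
      ShortComplex.moduleCat_exact_iff]
    rfl
  rw [key]
  constructor
  · intro h
    refine ⟨fun a b ↦ ?_⟩
    rw [← sub_eq_zero]
    obtain ⟨f, hf, hfe⟩ := P.extMk_surjective (a - b) (p + 2) rfl
    rw [← hfe]
    exact (P.extMk_eq_zero_iff f (p + 2) rfl hf p rfl).2 (h f hf)
  · intro h f hf
    exact (P.extMk_eq_zero_iff f (p + 2) rfl hf p rfl).1 (Subsingleton.elim _ _)

lemma subsingleton_ext_of_iso_left [HasExt.{v} 𝓐] {X X' : 𝓐} (e : X ≅ X') (Y : 𝓐) (i : ℕ)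
    [Subsingleton (Abelian.Ext X Y i)] : Subsingleton (Abelian.Ext X' Y i) :=
  Function.Injective.subsingleton
    (f := fun a : Abelian.Ext X' Y i ↦ (Abelian.Ext.mk₀ e.hom).comp a (zero_add i))
    (Function.LeftInverse.injective
      (g := fun b ↦ (Abelian.Ext.mk₀ e.inv).comp b (zero_add i)) fun a ↦ by simp)

lemma subsingleton_ext_of_iso_right [HasExt.{v} 𝓐] (X : 𝓐) {Y Y' : 𝓐} (e : Y ≅ Y') (i : ℕ)
    [Subsingleton (Abelian.Ext X Y i)] : Subsingleton (Abelian.Ext X Y' i) :=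
  Function.Injective.subsingleton
    (f := fun a : Abelian.Ext X Y' i ↦ a.comp (Abelian.Ext.mk₀ e.inv) (add_zero i))
    (Function.LeftInverse.injective
      (g := fun b ↦ b.comp (Abelian.Ext.mk₀ e.hom) (add_zero i)) fun a ↦ by simp)

lemma subsingleton_ext_of_mem_addOf_left [HasExt.{v} 𝓐] {X T : 𝓐} (hX : X ∈ addOf T) (Y : 𝓐)
    (i : ℕ) [hT : Subsingleton (Abelian.Ext T Y i)] : Subsingleton (Abelian.Ext X Y i) := by
  obtain ⟨n, X', ⟨e⟩⟩ := hX
  have hn : Subsingleton (Abelian.Ext (nsum T n) Y i) := by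
    clear e
    induction n with
    | zero => exact hT
    | succ n ih => exact Abelian.Ext.biprodAddEquiv.subsingleton
  have := subsingleton_ext_of_iso_left e.symm Y i
  exact (Prod.fst_surjective.comp Abelian.Ext.biprodAddEquiv.surjective :
    Function.Surjective fun a : Abelian.Ext (X ⊞ X') Y i ↦
      (Abelian.Ext.biprodAddEquiv a).1).subsingleton

lemma subsingleton_ext_of_mem_addOf_right [HasExt.{v} 𝓐] (X : 𝓐) {Y T : 𝓐} (hY : Y ∈ addOf T)
    (i : ℕ) [hT : Subsingleton (Abelian.Ext X T i)] : Subsingleton (Abelian.Ext X Y i) := by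
  obtain ⟨n, Y', ⟨e⟩⟩ := hY
  have hn : Subsingleton (Abelian.Ext X (nsum T n) i) := by
    clear e
    induction n with
    | zero => exact hT
    | succ n ih => exact Abelian.Ext.addEquivBiprod.subsingleton
  have := subsingleton_ext_of_iso_right X e.symm i
  exact (Prod.fst_surjective.comp Abelian.Ext.addEquivBiprod.surjective :
    Function.Surjective fun a : Abelian.Ext X (Y ⊞ Y') i ↦
      (Abelian.Ext.addEquivBiprod a).1).subsingleton

/-- The additive closure of a self-orthogonal object is a self-orthogonal class. -/
lemma selfOrth_addOf [EnoughProjectives 𝓐] {T : 𝓐} (hT : ∀ i ≥ 1, extZero 𝓐 i T T) : SelfOrth (addOf T) := by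
  have : HasExt.{v} 𝓐 := hasExt_of_enoughProjectives.{v} 𝓐
  intro W hW W' hW' i hi
  have := (extZero_iff_subsingleton hi T T).1 (hT i hi)
  have := subsingleton_ext_of_mem_addOf_right T hW' i
  exact (extZero_iff_subsingleton hi W W').2 (subsingleton_ext_of_mem_addOf_left hW W' i)

/-- If `Ext^i(X, -)` vanishes on the middle term of a short exact sequence and `Ext^(i+1)(X, -)`
vanishes on the left term, then `Ext^i(X, -)` vanishes on the right term. -/
lemma extZero_of_SES [EnoughProjectives 𝓐] {K W Z : 𝓐} (h : SES K W Z) (X : 𝓐) {i : ℕ} (hi : 1 ≤ i)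
    (hW : extZero 𝓐 i X W) (hK : extZero 𝓐 (i + 1) X K) : extZero 𝓐 i X Z := by
  have : HasExt.{v} 𝓐 := hasExt_of_enoughProjectives.{v} 𝓐
  rw [extZero_iff_subsingleton (by omega)] at hW hK ⊢
  obtain ⟨f, g, w, hS⟩ := h
  refine subsingleton_of_forall_eq 0 fun x ↦ ?_
  obtain ⟨y, rfl⟩ := Abelian.Ext.covariant_sequence_exact₃ X hS x rfl
    (@Subsingleton.elim _ hK _ _)
  rw [@Subsingleton.elim _ hW y 0, Abelian.Ext.zero_comp]

/-- A short exact sequence `0 → K → W → M → 0` with `Ext^1(M, K) = 0` splits. -/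
lemma nonempty_iso_biprod_of_SES [EnoughProjectives 𝓐] {K W M : 𝓐} (h : SES K W M) (hE : extZero 𝓐 1 M K) :
    Nonempty (W ≅ K ⊞ M) := by
  have : HasExt.{v} 𝓐 := hasExt_of_enoughProjectives.{v} 𝓐
  rw [extZero_iff_subsingleton le_rfl] at hE
  obtain ⟨f, g, w, hS⟩ := h
  obtain ⟨x, hx⟩ := Abelian.Ext.covariant_sequence_exact₃ M hS (Abelian.Ext.mk₀ (𝟙 M))
    (zero_add 1) (@Subsingleton.elim _ hE _ _)
  obtain ⟨s, rfl⟩ := (Abelian.Ext.mk₀_bijective _ _).2 x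
  rw [Abelian.Ext.mk₀_comp_mk₀] at hx
  have hs : s ≫ g = 𝟙 M := (Abelian.Ext.mk₀_bijective _ _).1 hx
  have := hS.mono_f
  exact ⟨(ShortComplex.Splitting.ofExactOfSection _ hS.exact s hs this).isoBinaryBiproduct⟩

lemma mem_addOf_of_iso_biprod {T W K M : 𝓐} (hW : W ∈ addOf T) (e : W ≅ K ⊞ M) :
    M ∈ addOf T := by
  obtain ⟨n, Y, ⟨e'⟩⟩ := hW
  let assoc : (M ⊞ K) ⊞ Y ≅ M ⊞ (K ⊞ Y) := biprod.associator M K Y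
  exact ⟨n, K ⊞ Y, ⟨assoc.symm ≪≫
    biprod.mapIso (biprod.braiding M K ≪≫ e.symm) (Iso.refl Y) ≪≫ e'⟩⟩

lemma mem_addOf_of_isZero {T Z : 𝓐} (hZ : IsZero Z) : Z ∈ addOf T :=
  ⟨0, T, ⟨(isoZeroBiprod hZ).symm⟩⟩

lemma SES_of_isZero {Z : 𝓐} (hZ : IsZero Z) (Y : 𝓐) : SES Z Y Y := by
  refine ⟨0, 𝟙 Y, by simp, ?_⟩
  exact
    { exact := (ShortComplex.exact_iff_mono _ (hZ.eq_of_src _ _)).2 (inferInstanceAs (Mono (𝟙 Y)))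
      mono_f := ⟨fun _ _ _ ↦ hZ.eq_of_tgt _ _⟩
      epi_g := inferInstanceAs (Epi (𝟙 Y)) }

lemma subset_omX [EnoughProjectives 𝓐] {ω : Set 𝓐} (hω : SelfOrth ω) {Z : 𝓐} (hZ : IsZero Z)
    (hZω : Z ∈ ω) : ω ⊆ omX ω := by
  intro X hX
  let K : ℕ → 𝓐 := fun i ↦ if i = 0 then X else Z
  refine ⟨K, K, rfl, fun i ↦ ?_, fun i W hW ↦ hω W hW Z hZω, fun i ↦ SES_of_isZero hZ (K i)⟩
  by_cases h : i = 0 <;> simp [K, h, hX, hZω]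

lemma subset_leftPerp_omX [EnoughProjectives 𝓐] {ω : Set 𝓐} (hω : SelfOrth ω) : ω ⊆ leftPerp (omX ω) := by
  rintro X hX _ ⟨K, W, rfl, hW, hK, hS⟩ i hi
  exact extZero_of_SES (hS 0) X hi (hω X hX _ (hW 0) i hi) (hK 0 X hX (i + 1) (by omega))

lemma leftPerp_omX_inter_omX [EnoughProjectives 𝓐] {T : 𝓐} (hT : ∀ i ≥ 1, extZero 𝓐 i T T) :
    leftPerp (omX (addOf T)) ∩ omX (addOf T) = addOf T := by
  have hω := selfOrth_addOf hT
  apply Set.Subset.antisymm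
  · rintro _ ⟨hM, K, W, rfl, hW, hK, hS⟩
    have hK1 : K 1 ∈ omX (addOf T) :=
      ⟨fun i ↦ K (i + 1), fun i ↦ W (i + 1), rfl, fun i ↦ hW _, fun i ↦ hK _, fun i ↦ hS _⟩
    obtain ⟨e⟩ := nonempty_iso_biprod_of_SES (hS 0) (hM _ hK1 1 le_rfl)
    exact mem_addOf_of_iso_biprod (hW 0) e
  · exact Set.subset_inter (subset_leftPerp_omX hω)
      (subset_omX hω (isZero_zero 𝓐) (mem_addOf_of_isZero (isZero_zero 𝓐)))

end AbelianCategory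

section ArtinAlgebra

variable {R : Type} [CommRing R] [IsArtinianRing R]
variable {A : Type} [Ring A] [Algebra R A] [Module.Finite R A]
variable [Abelian (FGModuleCat A)] [EnoughProjectives (FGModuleCat A)]
variable [EnoughInjectives (FGModuleCat A)]

theorem stmt18 (Cm Tm : FGModuleCat A) (htilt : TiltingPair A Cm Tm) :
    leftPerp (omX (addOf Tm)) ∩ omX (addOf Tm) = addOf Tm :=
  leftPerp_omX_inter_omX htilt.2.1

end ArtinAlgebra
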